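/- Let n, r ∈ ℕ with n, r ≥ 1, let i ∈ ℕ with 1 ≤ i ≤ (n+1)^r, let G be a finite directed graph of order |V(G)| ≤ n, and let v ∈ V(G). Then there exist a rooted tree T and mappings v' : V(T) → V(H_{v,i}) and W : V(T) → 2^{V(H_{v,i})} satisfying conditions (1)–(4) of the tree-decomposition lemma for the rooted DAG H_{v,i} (namely: |W(t)| ≤ 1 for all t; t is a leaf of T iff v'(t) is a leaf of H_{v,i} or W(t) = {v'(t)}; if t is not a leaf of T and W(t) = {w} then v'(t) ◁ w; and if t has children u_1,…,u_k with k ≥ 1 then V((H_{v,i})_{v'(t)}^{W(t)}) \ {v'(t)} ⊆ ⋃_{j=1}^k V((H_{v,i})_{v'(u_j)}^{W(u_j)})), such that the height of T is at most (4r+2)·log₂(n+1). -/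

import Mathlib

/-- The in-degree of `w` in the digraph with edge relation `E`. -/
noncomputable def degIn {V : Type} (E : V → V → Prop) (w : V) : ℕ :=
  Set.ncard {u | E u w}

/-- The edge relation of the resource-unfolding graphs `H_{v,i}`: there is an edge from
`(v', i')` to `(w, j)` iff `w` is an out-neighbour of `v'` in `G`,
`j = ⌊(i' − 1)/deg⁻_G(w)⌋` and `j ≥ 1`. -/
noncomputable def HAdj {V : Type} (E : V → V → Prop) : V × ℕ → V × ℕ → Prop :=
  fun a b => E a.1 b.1 ∧ b.2 = (a.2 - 1) / degIn E b.1 ∧ 1 ≤ b.2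

/-- The vertex set of `H_{v,i}`: the pair `(v, i)` together with all pairs reachable
from `(v, i)` under the edge relation `HAdj E`. -/
def HVerts {V : Type} (E : V → V → Prop) (v : V) (i : ℕ) : Set (V × ℕ) :=
  {x | Relation.ReflTransGen (HAdj E) (v, i) x}

/-- The vertex set of the subgraph `H_s^W` of a rooted DAG with edge relation `A`:
all vertices `u` such that there is a directed path `(x_0, …, x_ℓ)` with `x_0 = s`,
`x_ℓ = u` and `{x_0, …, x_{ℓ-1}} ∩ W = ∅`. -/
def vertexSet {α : Type} (A : α → α → Prop) (s : α) (W : Set α) : Set α :=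
  {u | ∃ p : List α, p.Chain' A ∧ p.head? = some s ∧ p.getLast? = some u ∧
    ∀ x ∈ p.dropLast, x ∉ W}

/-- The height of a rooted tree with child relation `child` and root `rt`:
the number of edges on a longest directed path starting at the root. -/
noncomputable def treeHeight {T : Type} (child : T → T → Prop) (rt : T) : ℕ :=
  sSup {n : ℕ | ∃ p : List T, p.Chain' child ∧ p.head? = some rt ∧ p.length = n + 1}

open Relation in
/-- Unfolding a finite decreasing successor function into a finite rooted tree. -/
theorem exists_unfolding_tree {S : Type} [Finite S] (next : S → Set S) (B : S → ℕ)
    (hB : ∀ s, ∀ t ∈ next s, B t < B s) (s0 : S) :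
    ∃ (T : Type) (_ : Fintype T) (child : T → T → Prop) (rt : T) (lab : T → S),
      lab rt = s0 ∧
      (∀ t : T, ReflTransGen child rt t) ∧
      (∀ t : T, ¬ TransGen child t t) ∧
      (∀ t : T, t ≠ rt → ∃! s : T, child s t) ∧
      (∀ s : T, ¬ child s rt) ∧
      (∀ t c, c ∈ next (lab t) ↔ ∃ u, child t u ∧ lab u = c) ∧
      treeHeight child rt ≤ B s0 := by
  let P : S × List S → Prop := fun p =>
    (p.1 :: p.2).IsChain (fun b a => b ∈ next a) ∧ (p.1 :: p.2).getLast? = some s0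
  have hlen : ∀ (l : List S) (a : S), P (a, l) → B a + l.length ≤ B s0 := by
    intro l
    induction l with
    | nil =>
      rintro a ⟨-, h⟩
      simp at h
      simp [h]
    | cons b l ih =>
      rintro a ⟨hc, h⟩
      rw [List.isChain_cons_cons] at hc
      have h1 := ih b ⟨hc.2, by simpa [List.getLast?_cons_cons] using h⟩
      have h2 : B a < B b := hB _ _ hc.1
      simp only [List.length_cons]
      omega
  have hfin : Finite {p : S × List S // P p} := by
    have h1 : {l : List S | l.length ≤ B s0}.Finite := List.finite_length_le S (B s0)
    refine Set.Finite.subset ((Set.finite_univ (α := S)).prod h1) ?_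
    rintro ⟨a, l⟩ h
    have := hlen l a h
    simp only [Set.mem_prod, Set.mem_univ, Set.mem_ofPred_eq, true_and]
    omega
  let T := {p : S × List S // P p}
  let child : T → T → Prop := fun s t => t.1.2 = s.1.1 :: s.1.2
  let rt : T := ⟨(s0, []), by simp [P]⟩
  have hrt : ∀ t : T, t.1.2 = [] → t = rt := by
    rintro ⟨⟨a, l⟩, h⟩ rfl
    have : a = s0 := by simpa using h.2
    subst this
    rfl
  have hpar : ∀ (a b : S) (l : List S), P (a, b :: l) → P (b, l) := by
    rintro a b l ⟨hc, h⟩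
    rw [List.isChain_cons_cons] at hc
    exact ⟨hc.2, by simpa [List.getLast?_cons_cons] using h⟩
  have hnext : ∀ (t : T) (c : S), c ∈ next t.1.1 ↔ ∃ u : T, child t u ∧ u.1.1 = c := by
    rintro ⟨⟨a, l⟩, h⟩ c
    constructor
    · intro hc
      refine ⟨⟨(c, a :: l), ?_, ?_⟩, rfl, rfl⟩
      · exact List.isChain_cons_cons.2 ⟨hc, h.1⟩
      · simpa [List.getLast?_cons_cons] using h.2
    · rintro ⟨⟨⟨c', l'⟩, h'⟩, hl, rfl⟩
      obtain rfl : l' = a :: l := hl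
      exact (List.isChain_cons_cons.1 h'.1).1
  have hchild : ∀ s t : T, child s t → B t.1.1 < B s.1.1 := fun s t h =>
    hB _ _ ((hnext s t.1.1).2 ⟨t, h, rfl⟩)
  refine ⟨T, Fintype.ofFinite T, child, rt, fun t => t.1.1, rfl, ?_, ?_, ?_, ?_, hnext, ?_⟩
  · suffices ∀ (l : List S) (a : S) (h : P (a, l)), ReflTransGen child rt ⟨(a, l), h⟩ from
      fun t => this t.1.2 t.1.1 t.2
    intro l
    induction l with
    | nil =>
      intro a h
      rw [hrt ⟨(a, []), h⟩ rfl]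
    | cons b l ih =>
      intro a h
      exact (ih b (hpar a b l h)).tail rfl
  · intro t ht
    have : ∀ s t : T, TransGen child s t → B t.1.1 < B s.1.1 := by
      intro s t h
      induction h with
      | single h => exact hchild _ _ h
      | tail _ h ih => exact (hchild _ _ h).trans ih
    exact lt_irrefl _ (this t t ht)
  · rintro ⟨⟨a, l⟩, h⟩ hne
    cases l with
    | nil => exact absurd (hrt _ rfl) hne
    | cons b l =>
      refine ⟨⟨(b, l), hpar a b l h⟩, rfl, ?_⟩
      rintro ⟨⟨b', l'⟩, h'⟩ hl
      have hl' : b :: l = b' :: l' := hl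
      obtain ⟨rfl, rfl⟩ := List.cons.inj hl'
      rfl
  · intro s hs
    exact List.cons_ne_nil _ _ (Eq.symm hs)
  · refine csSup_le' ?_
    rintro k ⟨p, hp, hhead, hk⟩
    have key : ∀ (p : List T) (t : T), (t :: p).IsChain child → p.length ≤ B t.1.1 := by
      intro p
      induction p with
      | nil => simp
      | cons u p ih =>
        intro t h
        rw [List.isChain_cons_cons] at h
        have h1 := ih u h.2
        have h2 := hchild _ _ h.1
        simp only [List.length_cons]
        omega
    cases p with
    | nil => simp at hhead
    | cons t p =>
      obtain rfl : t = rt := by simpa using hhead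
      have := key p rt hp
      simp only [List.length_cons] at hk
      change k ≤ B rt.1.1
      omega

theorem self_mem_vertexSet {α : Type} (A : α → α → Prop) (s : α) (W : Set α) :
    s ∈ vertexSet A s W :=
  ⟨[s], List.isChain_singleton s, by simp, by simp, by simp⟩

theorem vertexSet_antitone {α : Type} (A : α → α → Prop) (s : α) {W W' : Set α} (h : W ⊆ W') :
    vertexSet A s W' ⊆ vertexSet A s W := by
  rintro u ⟨p, h1, h2, h3, h4⟩
  exact ⟨p, h1, h2, h3, fun x hx hW => h4 x hx (h hW)⟩

theorem mem_vertexSet_of_adj {α : Type} {A : α → α → Prop} {s c u : α} {W : Set α}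
    (hs : s ∉ W) (hc : A s c) (hu : u ∈ vertexSet A c W) : u ∈ vertexSet A s W := by
  obtain ⟨p, h1, h2, h3, h4⟩ := hu
  cases p with
  | nil => simp at h2
  | cons b p =>
    obtain rfl : b = c := by simpa using h2
    refine ⟨s :: b :: p, List.isChain_cons_cons.2 ⟨hc, h1⟩, rfl,
      by simpa [List.getLast?_cons_cons] using h3, ?_⟩
    intro x hx
    rw [List.dropLast_cons_cons] at hx
    rcases List.mem_cons.1 hx with rfl | hx
    · exact hs
    · exact h4 x hx

/-- Every vertex of `H_s^W` lies in `H_s^{u}` or in `H_c^W` for some out-neighbour `c` of `u`. -/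
theorem vertexSet_split {α : Type} {A : α → α → Prop} {s x : α} {W : Set α} (u : α)
    (hx : x ∈ vertexSet A s W) :
    x ∈ vertexSet A s {u} ∨ ∃ c, A u c ∧ x ∈ vertexSet A c W := by
  obtain ⟨p, h1, h2, h3, h4⟩ := hx
  induction p generalizing s with
  | nil => simp at h2
  | cons b p ih =>
    obtain rfl : b = s := by simpa using h2
    cases p with
    | nil =>
      obtain rfl : b = x := by simpa using h3
      exact Or.inl (self_mem_vertexSet A b {u})
    | cons c p =>
      have h1' := List.isChain_cons_cons.1 h1
      rw [List.getLast?_cons_cons] at h3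
      rw [List.dropLast_cons_cons] at h4
      have h5 : ∀ y ∈ (c :: p).dropLast, y ∉ W := fun y hy => h4 y (List.mem_cons_of_mem _ hy)
      by_cases hbu : b = u
      · subst hbu
        exact Or.inr ⟨c, h1'.1, c :: p, h1'.2, rfl, h3, h5⟩
      · rcases ih h1'.2 rfl h3 h5 with h | h
        · exact Or.inl (mem_vertexSet_of_adj (by simpa using hbu) h1'.1 h)
        · exact Or.inr h

theorem size_div_two_lt {a b : ℕ} (hb : 1 ≤ b) (h : 2 * a ≤ b) :
    Nat.size a + 1 ≤ Nat.size b := by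
  rw [Nat.succ_le_iff, Nat.lt_size]
  rcases Nat.eq_zero_or_pos a with rfl | ha
  · simpa using hb
  · have h1 : Nat.size a - 1 < Nat.size a := by
      have := Nat.size_pos.2 ha
      omega
    have h2 := Nat.lt_size.1 h1
    calc 2 ^ Nat.size a = 2 * 2 ^ (Nat.size a - 1) := by
          rw [← pow_succ']; congr 1; omega
      _ ≤ b := by omega

/-- The singleton of the value of an option, or the empty set. -/
def optionSet {α : Type} (o : Option α) : Set α := {x | o = some x}

theorem optionSet_none {α : Type} : optionSet (none : Option α) = ∅ := by
  ext; simp [optionSet]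

theorem optionSet_some {α : Type} (w : α) : optionSet (some w) = {w} := by
  ext; simp [optionSet, eq_comm]

/-- The bound on the height of the decomposition tree of `H_x^W`, in terms of a size function. -/
def heightBound {α : Type} (e : α → ℕ) (x : α) : Option α → ℕ
  | none => 2 * Nat.size (e x) - 1
  | some w => 2 * Nat.size (e x - e w)

section Decomposition

open Relation

variable {α : Type} {A : α → α → Prop} {e : α → ℕ}

theorem size_le_of_reaches (h : ∀ x y, A x y → e y < e x) {x y : α} (hxy : ReflTransGen A x y) :
    e y ≤ e x := by
  induction hxy with
  | refl => rfl
  | tail _ hA ih => exact (h _ _ hA).le.trans ih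

theorem exists_last_above (h : ∀ x y, A x y → e y < e x) (Q : α → Prop) (k : ℕ) {x : α}
    (hQ : Q x) (hk : k ≤ 2 * e x) :
    ∃ u, ReflTransGen A x u ∧ Q u ∧ k ≤ 2 * e u ∧ ∀ c, A u c → Q c → 2 * e c < k := by
  induction hn : e x using Nat.strong_induction_on generalizing x with
  | _ m ih =>
    subst hn
    by_cases hc : ∃ c, A x c ∧ Q c ∧ k ≤ 2 * e c
    · obtain ⟨c, hxc, hQc, hkc⟩ := hc
      obtain ⟨u, hu, h'⟩ := ih (e c) (h _ _ hxc) hQc hkc rfl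
      exact ⟨u, ReflTransGen.head hxc hu, h'⟩
    · push Not at hc
      exact ⟨x, .refl, hQ, hk, hc⟩

/-- One decomposition step: a non-terminal pair `(x, W)` is covered by pairs of smaller bound. -/
theorem exists_decomposition_step (h1 : ∀ x y, A x y → e y < e x)
    (h2 : ∀ x y z, A x y → A x z → y ≠ z → e y + e z < e x)
    (x : α) (o : Option α) (ho : ∀ w, o = some w → ReflTransGen A x w)
    (hx : ∃ y, A x y) (hne : o ≠ some x) :
    ∃ u, ReflTransGen A x u ∧ heightBound e x (some u) < heightBound e x o ∧
      ∀ c, A u c → ∃ o' : Option α, (∀ w, o' = some w → o = some w ∧ ReflTransGen A c w) ∧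
        heightBound e c o' < heightBound e x o := by
  cases o with
  | none =>
    obtain ⟨u, hu, -, hku, hc⟩ := exists_last_above h1 (fun _ => True) (e x) (x := x) trivial
      (by omega)
    obtain ⟨y, hy⟩ := hx
    have hpos := h1 _ _ hy
    refine ⟨u, hu, ?_, fun c huc => ⟨none, by simp, ?_⟩⟩
    · have := size_div_two_lt (a := e x - e u) (b := e x) (by omega) (by omega)
      simp only [heightBound]
      omega
    · have := size_div_two_lt (a := e c) (b := e x) (by omega) (hc c huc trivial).le
      simp only [heightBound]
      omega
  | some w =>
    have hxw := ho w rfl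
    have hlt : e w < e x := by
      rcases ReflTransGen.cases_head hxw with rfl | ⟨c, hxc, hcw⟩
      · exact absurd rfl hne
      · exact (size_le_of_reaches h1 hcw).trans_lt (h1 _ _ hxc)
    obtain ⟨u, hu, huw, hku, hc⟩ := exists_last_above h1 (fun z => ReflTransGen A z w)
      (e x + e w) (x := x) hxw (by omega)
    have hux := size_le_of_reaches h1 hu
    refine ⟨u, hu, ?_, fun c huc => ?_⟩
    · have := size_div_two_lt (a := e x - e u) (b := e x - e w) (by omega) (by omega)
      simp only [heightBound]
      omega
    · by_cases hcw : ReflTransGen A c w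
      · refine ⟨some w, fun w' hw' => ⟨hw', by cases hw'; exact hcw⟩, ?_⟩
        have := hc c huc hcw
        have := size_div_two_lt (a := e c - e w) (b := e x - e w) (by omega) (by omega)
        simp only [heightBound]
        omega
      · refine ⟨none, by simp, ?_⟩
        rcases ReflTransGen.cases_head huw with rfl | ⟨c', huc', hcw'⟩
        · omega
        · have h3 := h2 u c c' huc huc' (by rintro rfl; exact hcw hcw')
          have h4 := size_le_of_reaches h1 hcw'
          have h5 := Nat.size_le_size (show e c ≤ e x - e w by omega)
          have h6 : 0 < Nat.size (e x - e w) := Nat.size_pos.2 (by omega)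
          simp only [heightBound]
          omega

/-- The tree-decomposition lemma for rooted DAGs with a size function. -/
theorem exists_tree_decomposition (h1 : ∀ x y, A x y → e y < e x)
    (h2 : ∀ x y z, A x y → A x z → y ≠ z → e y + e z < e x)
    (s0 : α) (hfin : {x | ReflTransGen A s0 x}.Finite) :
    ∃ (T : Type) (_ : Fintype T) (child : T → T → Prop) (rt : T) (vm : T → α) (Wm : T → Set α),
      (∀ t : T, vm t ∈ {x | ReflTransGen A s0 x}) ∧
      (∀ t : T, Wm t ⊆ {x | ReflTransGen A s0 x}) ∧
      (∀ t : T, ReflTransGen child rt t) ∧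
      (∀ t : T, ¬ TransGen child t t) ∧
      (∀ t : T, t ≠ rt → ∃! s : T, child s t) ∧
      (∀ s : T, ¬ child s rt) ∧
      (∀ t : T, (Wm t).Subsingleton) ∧
      (∀ t : T, (∀ u : T, ¬ child t u) ↔ ((∀ y, ¬ A (vm t) y) ∨ Wm t = {vm t})) ∧
      (∀ (t : T) (w : α), (∃ u : T, child t u) → Wm t = {w} →
        ReflTransGen A (vm t) w ∧ vm t ≠ w) ∧
      (∀ t : T, (∃ u : T, child t u) →
        ∀ x ∈ vertexSet A (vm t) (Wm t), x ≠ vm t →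
          ∃ u : T, child t u ∧ x ∈ vertexSet A (vm u) (Wm u)) ∧
      treeHeight child rt ≤ 2 * Nat.size (e s0) - 1 := by
  let R := {x | ReflTransGen A s0 x}
  let U := {p : α × Option α // p.1 ∈ R ∧ ∀ w, p.2 = some w → ReflTransGen A p.1 w}
  have hU : ∀ (s : U) w, s.1.2 = some w → w ∈ R := fun s w hw =>
    ReflTransGen.trans s.2.1 (s.2.2 w hw)
  have hUfin : Finite U := by
    have : Finite R := hfin
    refine Finite.of_injective (β := R × Option R)
      (fun s => (⟨s.1.1, s.2.1⟩, s.1.2.pmap (fun w hw => ⟨w, hw⟩) (hU s))) ?_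
    rintro ⟨⟨a, o⟩, ha⟩ ⟨⟨b, o'⟩, hb⟩ hab
    simp only [Prod.mk.injEq, Subtype.mk.injEq] at hab
    obtain ⟨rfl, h⟩ := hab
    congr
    cases o <;> cases o' <;> simp_all
  have hstep : ∀ s : U, ∃ C : Set U,
      (C = ∅ ↔ (∀ y, ¬ A s.1.1 y) ∨ s.1.2 = some s.1.1) ∧
      (∀ t ∈ C, heightBound e t.1.1 t.1.2 < heightBound e s.1.1 s.1.2) ∧
      (C.Nonempty → ∀ x ∈ vertexSet A s.1.1 (optionSet s.1.2),
        ∃ t ∈ C, x ∈ vertexSet A t.1.1 (optionSet t.1.2)) := by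
    rintro ⟨⟨x, o⟩, hxR, ho⟩
    by_cases hterm : (∀ y, ¬ A x y) ∨ o = some x
    · exact ⟨∅, by simpa using hterm, by simp, by simp⟩
    have hterm' := hterm
    push Not at hterm'
    obtain ⟨u, hu, hBu, hc⟩ := exists_decomposition_step h1 h2 x o ho hterm'.1 hterm'.2
    refine ⟨{t | heightBound e t.1.1 t.1.2 < heightBound e x o}, ?_, fun t ht => ht, ?_⟩
    · refine iff_of_false ?_ hterm
      refine Set.Nonempty.ne_empty ⟨⟨(x, some u), hxR, ?_⟩, hBu⟩
      rintro w hw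
      cases hw
      exact hu
    · rintro - z hz
      rcases vertexSet_split u hz with h | ⟨c, huc, h⟩
      · refine ⟨⟨(x, some u), hxR, ?_⟩, hBu, ?_⟩
        · rintro w hw
          cases hw
          exact hu
        · simpa [optionSet_some] using h
      · obtain ⟨o', ho', hB⟩ := hc c huc
        refine ⟨⟨(c, o'), ?_, fun w hw => (ho' w hw).2⟩, hB, ?_⟩
        · exact (ReflTransGen.trans hxR hu).tail huc
        · exact vertexSet_antitone A c (fun w hw => (ho' w hw).1) h
  choose next hempty hdec hcov using hstep
  obtain ⟨T, hT, child, rt, lab, hlab, t1, t2, t3, t4, hnext, hheight⟩ :=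
    exists_unfolding_tree next (fun s : U => heightBound e s.1.1 s.1.2) hdec
      ⟨(s0, none), ReflTransGen.refl, by simp⟩
  have hleaf : ∀ t : T, (∀ u, ¬ child t u) ↔ next (lab t) = ∅ := by
    intro t
    rw [Set.eq_empty_iff_forall_notMem]
    constructor
    · intro h c hc
      obtain ⟨u, hu, -⟩ := (hnext t c).1 hc
      exact h u hu
    · intro h u hu
      exact h _ ((hnext t _).2 ⟨u, hu, rfl⟩)
  have hopt : ∀ (o : Option α) (w : α), optionSet o = {w} ↔ o = some w := by
    intro o w
    constructor
    · intro h
      have : w ∈ optionSet o := by rw [h]; rfl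
      exact this
    · rintro rfl
      exact optionSet_some w
  refine ⟨T, hT, child, rt, fun t => (lab t).1.1, fun t => optionSet (lab t).1.2,
    fun t => (lab t).2.1, fun t w hw => hU _ w hw, t1, t2, t3, t4, ?_, ?_, ?_, ?_, hheight⟩
  · intro t a ha b hb
    exact Option.some.inj (Eq.trans (Eq.symm ha) hb)
  · intro t
    rw [hleaf, hempty, hopt]
  · rintro t w ⟨u, hu⟩ hw
    rw [hopt] at hw
    refine ⟨(lab t).2.2 w hw, ?_⟩
    rintro heq
    refine (hleaf t).2 ((hempty _).2 (Or.inr ?_)) u hu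
    rw [hw, ← heq]
  · rintro t ⟨u, hu⟩ x hx -
    obtain ⟨c, hc, hxc⟩ := hcov (lab t) ⟨_, (hnext t _).2 ⟨u, hu, rfl⟩⟩ x hx
    obtain ⟨u', hu', rfl⟩ := (hnext t c).1 hc
    exact ⟨u', hu', hxc⟩

end Decomposition

section Counting

variable {V : Type} (E : V → V → Prop)

theorem HAdj_snd_lt {a b : V × ℕ} (h : HAdj E a b) : b.2 < a.2 := by
  have h1 : b.2 ≤ a.2 - 1 := by rw [h.2.1]; exact Nat.div_le_self _ _
  have := h.2.2
  omega

variable [Fintype V]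

open Classical in
theorem degIn_eq_card (w : V) : degIn E w = (Finset.univ.filter (fun u => E u w)).card := by
  rw [degIn, Set.ncard_eq_toFinset_card']
  congr 1
  ext
  simp

theorem degIn_pos {u w : V} (h : E u w) : 0 < degIn E w :=
  (Set.ncard_pos (Set.toFinite _)).2 ⟨u, h⟩

open Classical in
/-- The out-neighbours of a vertex of the resource-unfolding graph. -/
noncomputable def HOut (a : V × ℕ) : Finset (V × ℕ) :=
  (Finset.univ.image fun w => (w, (a.2 - 1) / degIn E w)).filter (HAdj E a)

theorem mem_HOut {a b : V × ℕ} : b ∈ HOut E a ↔ HAdj E a b := by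
  simp only [HOut, Finset.mem_filter, Finset.mem_image, Finset.mem_univ, true_and,
    and_iff_right_iff_imp]
  intro h
  exact ⟨b.1, by rw [← h.2.1]⟩

/-- The number of nontrivial directed paths starting at a vertex. -/
noncomputable def pathCount (a : V × ℕ) : ℕ :=
  ∑ b ∈ (HOut E a).attach, (1 + pathCount b.1)
termination_by a.2
decreasing_by exact HAdj_snd_lt E ((mem_HOut E).1 b.2)

theorem pathCount_eq (a : V × ℕ) : pathCount E a = ∑ b ∈ HOut E a, (1 + pathCount E b) := by
  rw [pathCount]
  exact Finset.sum_attach (HOut E a) (fun b => 1 + pathCount E b)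

theorem pathCount_lt {a b : V × ℕ} (h : HAdj E a b) : pathCount E b < pathCount E a := by
  have := Finset.single_le_sum (f := fun b => 1 + pathCount E b) (fun _ _ => Nat.zero_le _)
    ((mem_HOut E).2 h)
  rw [← pathCount_eq] at this
  omega

theorem pathCount_add_lt {a b c : V × ℕ} (hb : HAdj E a b) (hc : HAdj E a c) (hbc : b ≠ c) :
    pathCount E b + pathCount E c < pathCount E a := by
  classical
  have h : ({b, c} : Finset (V × ℕ)) ⊆ HOut E a := by
    intro x hx
    rw [mem_HOut]
    rcases Finset.mem_insert.1 hx with rfl | hx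
    · exact hb
    · rwa [Finset.mem_singleton.1 hx]
  have := Finset.sum_le_sum_of_subset (f := fun b => 1 + pathCount E b) h
  rw [← pathCount_eq, Finset.sum_pair hbc] at this
  omega

open Classical in
theorem countP_HOut (w : V) {j : ℕ} (hj : 1 ≤ j) (a : V × ℕ) :
    Multiset.countP (fun p => p.1 = w ∧ j ≤ p.2) (HOut E a).val =
      if E a.1 w ∧ j * degIn E w + 1 ≤ a.2 then 1 else 0 := by
  have hiff : ∀ u, E u w → ∀ m, (j ≤ (m - 1) / degIn E w ↔ j * degIn E w + 1 ≤ m) := by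
    intro u hu m
    have hd := degIn_pos E hu
    rw [Nat.le_div_iff_mul_le hd]
    have : 0 < j * degIn E w := Nat.mul_pos hj hd
    omega
  rw [Multiset.countP_eq_card_filter, ← Finset.filter_val, Finset.card_val]
  split_ifs with h
  · rw [Finset.card_eq_one]
    refine ⟨(w, (a.2 - 1) / degIn E w), ?_⟩
    ext ⟨b, k⟩
    simp only [Finset.mem_filter, mem_HOut, HAdj, Finset.mem_singleton, Prod.mk.injEq]
    constructor
    · rintro ⟨⟨-, h2, -⟩, rfl, -⟩
      exact ⟨rfl, h2⟩
    · rintro ⟨rfl, rfl⟩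
      have := (hiff _ h.1 a.2).2 h.2
      exact ⟨⟨h.1, rfl, hj.trans this⟩, rfl, this⟩
  · rw [Finset.card_eq_zero, Finset.filter_eq_empty_iff]
    rintro ⟨b, k⟩ hb ⟨rfl, hk⟩
    rw [mem_HOut] at hb
    obtain ⟨h1, h2, -⟩ := hb
    refine h ⟨h1, (hiff _ h1 a.2).1 ?_⟩
    exact hk.trans h2.le

open Classical in
theorem countP_bind_HOut (w : V) {j : ℕ} (hj : 1 ≤ j) (S : Multiset (V × ℕ)) :
    Multiset.countP (fun p => p.1 = w ∧ j ≤ p.2) (S.bind fun a => (HOut E a).val) =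
      ∑ u ∈ Finset.univ.filter (fun u => E u w),
        Multiset.countP (fun p => p.1 = u ∧ j * degIn E w + 1 ≤ p.2) S := by
  induction S using Multiset.induction_on with
  | empty => simp
  | cons a S ih =>
    rw [Multiset.cons_bind, Multiset.countP_add, ih, countP_HOut E w hj]
    simp only [Multiset.countP_cons, Finset.sum_add_distrib]
    rw [add_comm]
    congr 1
    by_cases h : j * degIn E w + 1 ≤ a.2 <;> simp [h, Finset.sum_ite_eq]

open Classical in
theorem two_mul_sum_pathCount_le (K : ℕ) (S : Multiset (V × ℕ))
    (hS : ∀ w j, 1 ≤ j → j * Multiset.countP (fun p => p.1 = w ∧ j ≤ p.2) S ≤ K) :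
    2 * (S.map (pathCount E)).sum ≤ Fintype.card V * (K * (K - 1)) := by
  induction K generalizing S with
  | zero =>
    have h0 : ∀ a ∈ S, pathCount E a = 0 := by
      intro a ha
      have h1 := hS a.1 1 le_rfl
      simp only [one_mul, Nat.le_zero, Multiset.countP_eq_zero] at h1
      have h2 : a.2 = 0 := by
        have := h1 a ha
        simp at this
        exact this
      rw [pathCount_eq]
      refine Finset.sum_eq_zero fun b hb => ?_
      have := HAdj_snd_lt E ((mem_HOut E).1 hb)
      omega
    rw [Multiset.map_congr rfl h0]
    simp
  | succ K ih =>
    set S' := S.bind fun a => (HOut E a).val with hS'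
    have hinv : ∀ w j, 1 ≤ j → j * Multiset.countP (fun p => p.1 = w ∧ j ≤ p.2) S' ≤ K := by
      intro w j hj
      rw [hS', countP_bind_HOut E w hj]
      rcases Nat.eq_zero_or_pos (degIn E w) with hd | hd
      · rw [degIn_eq_card, Finset.card_eq_zero] at hd
        simp [hd]
      refine Nat.le_of_mul_le_mul_left ?_ hd
      rw [Finset.mul_sum, Finset.mul_sum]
      refine (Finset.sum_le_card_nsmul _ _ K ?_).trans_eq (by rw [← degIn_eq_card, smul_eq_mul])
      intro u _
      have := hS u (j * degIn E w + 1) (by omega)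
      set X := Multiset.countP (fun p : V × ℕ => p.1 = u ∧ j * degIn E w + 1 ≤ p.2) S
      have heq : degIn E w * (j * X) + X = (j * degIn E w + 1) * X := by ring
      rcases Nat.eq_zero_or_pos X with hX | hX
      · simp [hX]
      · omega
    have hsum : (S.map (pathCount E)).sum = Multiset.card S' + (S'.map (pathCount E)).sum := by
      rw [hS', Multiset.card_bind, Multiset.map_bind, Multiset.sum_bind, ← Multiset.sum_map_add]
      congr 1
      refine Multiset.map_congr rfl fun a _ => ?_
      rw [pathCount_eq, Finset.sum_add_distrib, Finset.sum_const, smul_eq_mul, mul_one]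
      rfl
    have hcard : Multiset.card S' ≤ Fintype.card V * K := by
      have h1 : ∀ p ∈ S', 1 ≤ p.2 := by
        intro p hp
        obtain ⟨a, -, ha⟩ := Multiset.mem_bind.1 hp
        exact ((mem_HOut E).1 ha).2.2
      have h2 : Multiset.card S' =
          ∑ w : V, Multiset.countP (fun p => p.1 = w ∧ 1 ≤ p.2) S' := by
        clear_value S'
        clear hS' hinv hsum
        induction S' using Multiset.induction_on with
        | empty => simp
        | cons a S' ih =>
          have ha := h1 a (Multiset.mem_cons_self a S')
          rw [Multiset.card_cons, ih fun p hp => h1 p (Multiset.mem_cons_of_mem hp)]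
          simp [Multiset.countP_cons, Finset.sum_add_distrib, ha]
      rw [h2]
      refine (Finset.sum_le_card_nsmul _ _ K fun w _ => ?_).trans_eq (by simp)
      simpa using hinv w 1 le_rfl
    have := ih S' hinv
    rw [hsum]
    cases K with
    | zero => simp_all
    | succ K =>
      simp only [Nat.add_sub_cancel] at this ⊢
      nlinarith

theorem two_mul_pathCount_le (v : V) (i : ℕ) :
    2 * pathCount E (v, i) ≤ Fintype.card V * (i * (i - 1)) := by
  classical
  have := two_mul_sum_pathCount_le E i {(v, i)} (by
    intro w j _
    rw [← Multiset.cons_zero, Multiset.countP_cons]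
    simp only [Multiset.countP_zero]
    split_ifs with h
    · simpa using h.2
    · simp)
  simpa using this

theorem finite_HVerts (v : V) (i : ℕ) : (HVerts E v i).Finite := by
  refine ((Set.finite_univ (α := V)).prod (Set.finite_Iic i)).subset fun x hx => ?_
  refine ⟨trivial, ?_⟩
  have := size_le_of_reaches (e := Prod.snd) (fun _ _ h => HAdj_snd_lt E h) hx
  exact this

end Counting

theorem two_pow_size_le {m N : ℕ} (hN : 1 ≤ N) (h : 2 * m ≤ N) :
    2 ^ (2 * Nat.size m - 1) ≤ N ^ 2 := by
  rcases Nat.eq_zero_or_pos m with rfl | hm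
  · simpa using Nat.one_le_pow 2 N hN
  · have h1 : 0 < Nat.size m := Nat.size_pos.2 hm
    have h2 : 2 ^ (Nat.size m - 1) ≤ m := Nat.lt_size.1 (by omega)
    obtain ⟨k, hk⟩ : ∃ k, Nat.size m = k + 1 := ⟨Nat.size m - 1, by omega⟩
    rw [hk] at h2 ⊢
    simp only [Nat.add_sub_cancel] at h2
    have h3 : 2 * (k + 1) - 1 = k + k + 1 := by omega
    rw [h3, pow_succ, pow_add]
    have h4 : 2 * 2 ^ k ≤ N := by omega
    have h5 := Nat.pow_le_pow_left h4 2
    nlinarith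

/-- let `n, r ≥ 1`, `1 ≤ i ≤ (n+1)^r`, let `G` be a finite directed graph
with `|V(G)| ≤ n` and `v ∈ V(G)`. Then there are a rooted tree `T` and mappings
`vm : V(T) → V(H_{v,i})`, `Wm : V(T) → 2^{V(H_{v,i})}` satisfying conditions (1)–(4)
of the tree-decomposition lemma for the rooted DAG `H_{v,i}`, such that the height of
`T` is at most `(4r+2)·log₂(n+1)`. -/
theorem stmt11 {V : Type} [Fintype V] (E : V → V → Prop)
    (n r : ℕ) (hn : 1 ≤ n) (hr : 1 ≤ r)
    (i : ℕ) (hi1 : 1 ≤ i) (hi2 : i ≤ (n + 1) ^ r)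
    (hcard : Fintype.card V ≤ n) (v : V) :
    ∃ (T : Type) (_ : Fintype T) (child : T → T → Prop) (rt : T)
      (vm : T → V × ℕ) (Wm : T → Set (V × ℕ)),
      -- `vm` and `Wm` map into the vertices of `H_{v,i}`:
      (∀ t : T, vm t ∈ HVerts E v i) ∧
      (∀ t : T, Wm t ⊆ HVerts E v i) ∧
      -- `T` is a rooted tree with root `rt` and child relation `child`:
      (∀ t : T, Relation.ReflTransGen child rt t) ∧
      (∀ t : T, ¬ Relation.TransGen child t t) ∧
      (∀ t : T, t ≠ rt → ∃! s : T, child s t) ∧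
      (∀ s : T, ¬ child s rt) ∧
      -- (1)
      (∀ t : T, (Wm t).Subsingleton) ∧
      -- (2): `t` is a leaf of `T` iff `vm t` is a leaf of `H_{v,i}` or `Wm t = {vm t}`
      (∀ t : T, (∀ u : T, ¬ child t u) ↔
        ((∀ y : V × ℕ, ¬ HAdj E (vm t) y) ∨ Wm t = {vm t})) ∧
      -- (3)
      (∀ (t : T) (w : V × ℕ), (∃ u : T, child t u) → Wm t = {w} →
        Relation.ReflTransGen (HAdj E) (vm t) w ∧ vm t ≠ w) ∧
      -- (4)
      (∀ t : T, (∃ u : T, child t u) →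
        ∀ x ∈ vertexSet (HAdj E) (vm t) (Wm t), x ≠ vm t →
          ∃ u : T, child t u ∧ x ∈ vertexSet (HAdj E) (vm u) (Wm u)) ∧
      -- height bound
      (treeHeight child rt : ℝ) ≤ (4 * r + 2) * Real.logb 2 (n + 1) := by
  obtain ⟨T, hT, child, rt, vm, Wm, a1, a2, a3, a4, a5, a6, a7, a8, a9, a10, hheight⟩ :=
    exists_tree_decomposition (fun _ _ h => pathCount_lt E h)
      (fun _ _ _ h h' hne => pathCount_add_lt E h h' hne) (v, i) (finite_HVerts E v i)
  refine ⟨T, hT, child, rt, vm, Wm, a1, a2, a3, a4, a5, a6, a7, a8, a9, a10, ?_⟩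
  have hN : 2 * pathCount E (v, i) ≤ (n + 1) ^ (2 * r + 1) := by
    calc 2 * pathCount E (v, i) ≤ Fintype.card V * (i * (i - 1)) := two_mul_pathCount_le E v i
      _ ≤ (n + 1) * ((n + 1) ^ r * (n + 1) ^ r) :=
        Nat.mul_le_mul (by omega) (Nat.mul_le_mul hi2 (by omega))
      _ = (n + 1) ^ (2 * r + 1) := by ring
  have hpow : 2 ^ treeHeight child rt ≤ (n + 1) ^ (4 * r + 2) := by
    calc 2 ^ treeHeight child rt ≤ 2 ^ (2 * Nat.size (pathCount E (v, i)) - 1) :=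
        Nat.pow_le_pow_right (by norm_num) hheight
      _ ≤ ((n + 1) ^ (2 * r + 1)) ^ 2 := two_pow_size_le (Nat.one_le_pow _ _ (by omega)) hN
      _ = (n + 1) ^ (4 * r + 2) := by ring
  have hpow' : (2 : ℝ) ^ treeHeight child rt ≤ ((n : ℝ) + 1) ^ (4 * r + 2) := by
    exact_mod_cast hpow
  have hlog := Real.logb_le_logb_of_le (b := 2) (by norm_num) (by positivity) hpow'
  rw [Real.logb_pow, Real.logb_pow, Real.logb_self_eq_one (by norm_num)] at hlog
  push_cast at hlog
  linarith
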